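/- Let z be a point in ℝ^n and let g, c : ℝ^n → ℝ. Then there exists a slack σ ∈ ℝ with σ ≥ 0, g(z) + σ ≥ 0, and σ · c(z) ≤ 0 if and only if -min(g(z), 0) · c(z) ≤ 0. In particular, the continuous state-triggered constraint system is equivalent to the single inequality h(z) := -min(g(z), 0) · c(z) ≤ 0. -/

import Mathlib

/-- Continuous state-triggered constraints: the slack-variable system
`σ ≥ 0`, `g z + σ ≥ 0`, `σ * c z ≤ 0` is feasible iff the single
inequality `h z := -min (g z) 0 * c z ≤ 0` holds. -/
theorem stc_slack_iff (n : ℕ) (z : Fin n → ℝ) (g c : (Fin n → ℝ) → ℝ) :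
    (∃ σ : ℝ, σ ≥ 0 ∧ g z + σ ≥ 0 ∧ σ * c z ≤ 0) ↔ -min (g z) 0 * c z ≤ 0 := by
  have hmin : 0 ≤ -min (g z) 0 := neg_nonneg.mpr (min_le_right _ _)
  constructor
  · rintro ⟨σ, -, hg, hc⟩
    rcases le_or_gt (c z) 0 with h | h
    · exact mul_nonpos_of_nonneg_of_nonpos hmin h
    · have hσ : σ ≤ 0 := nonpos_of_mul_nonpos_left hc h
      rw [min_eq_right (by linarith : (0 : ℝ) ≤ g z)]
      simp
  · intro h
    exact ⟨-min (g z) 0, hmin, by linarith [min_le_left (g z) 0], h⟩
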